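/- Let Δ ≥ 4 be an integer, let G be a finite connected simple graph with maximum degree Δ not isomorphic to K_{Δ+1}, with minimum degree δ ≤ Δ−1. Let real numbers c_1, …, c_Δ satisfy c_Δ = 1/Δ and i·c_i + c_{i+1} = 1 for i = 1, …, Δ−1, and set f_G(v) = c_{d_G(v)} for each vertex v. Suppose u is a vertex of degree δ with f_G(u) + Σ_{w ∈ N_G(u)} f_G(w) ≤ 1. Let G′ be the induced subgraph of G on V(G) \ ({u} ∪ N_G(u)), let M be the set of isolated vertices of G′, and let C(G′) be the set of connected components of G′ having at least two vertices. Then α(G) ≥ Σ_{v ∈ M} f_G(v) + Σ_{H ∈ C(G′)} α(H) + f_G(u) + Σ_{w ∈ N_G(u)} f_G(w). -/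

import Mathlib

/-- A set of vertices is independent if its elements are pairwise nonadjacent. -/
def IsIndepSet {V : Type*} (G : SimpleGraph V) (s : Set V) : Prop :=
  s.Pairwise fun a b => ¬ G.Adj a b

/-- The independence number: the largest cardinality of an independent set of vertices. -/
noncomputable def indepNum {V : Type*} [Fintype V] (G : SimpleGraph V) : ℕ :=
  sSup {n | ∃ s : Finset V, IsIndepSet G ↑s ∧ s.card = n}

theorem IsIndepSet.card_le_indepNum {V : Type*} [Fintype V] {G : SimpleGraph V} {s : Finset V}
    (hs : IsIndepSet G ↑s) : s.card ≤ indepNum G :=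
  le_csSup ⟨Fintype.card V, by rintro n ⟨t, -, rfl⟩; exact t.card_le_univ⟩ ⟨s, hs, rfl⟩

theorem exists_isIndepSet_card_eq_indepNum {V : Type*} [Fintype V] (G : SimpleGraph V) :
    ∃ s : Finset V, IsIndepSet G ↑s ∧ s.card = indepNum G :=
  Nat.sSup_mem (s := {n | ∃ s : Finset V, IsIndepSet G ↑s ∧ s.card = n})
    ⟨0, ∅, by simp [IsIndepSet], rfl⟩
    ⟨Fintype.card V, by rintro n ⟨t, -, rfl⟩; exact t.card_le_univ⟩

theorem SimpleGraph.Reachable.eq_of_forall_not_adj {V : Type*} {G : SimpleGraph V} {v w : V}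
    (h : G.Reachable v w) (hv : ∀ x, ¬ G.Adj v x) : v = w := by
  obtain ⟨p⟩ := h
  cases p with
  | nil => rfl
  | cons hadj _ => exact absurd hadj (hv _)

open scoped Classical in
/-- The isolated vertices together with maximum independent sets of the nontrivial components
form an independent set. -/
theorem card_isolated_add_sum_indepNum_le {V : Type*} [Fintype V] (G : SimpleGraph V) :
    (Finset.univ.filter (fun v : V => G.degree v = 0)).card
      + ∑ comp ∈ Finset.univ.filter
          (fun comp : G.ConnectedComponent => 1 < Nat.card comp.supp),
        indepNum (G.induce comp.supp) ≤ indepNum G := by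
  choose s hs hcard using fun comp : G.ConnectedComponent =>
    exists_isIndepSet_card_eq_indepNum (G.induce comp.supp)
  set M := Finset.univ.filter (fun v : V => G.degree v = 0)
  set C := Finset.univ.filter (fun comp : G.ConnectedComponent => 1 < Nat.card comp.supp)
  let t : G.ConnectedComponent → Finset V := fun comp => (s comp).map (Function.Embedding.subtype _)
  have isolated : ∀ v ∈ M, ∀ x, ¬ G.Adj v x := by
    intro v hv x hx
    have h0 : G.degree v = 0 := (Finset.mem_filter.mp hv).2
    exact absurd ((G.degree_pos_iff_exists_adj v).mpr ⟨x, hx⟩) (by omega)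
  have mem_t : ∀ comp, ∀ v ∈ t comp, G.connectedComponentMk v = comp := by
    intro comp v hv
    obtain ⟨a, -, rfl⟩ := Finset.mem_map.mp hv
    exact a.2
  have disj : Disjoint M (C.biUnion t) := by
    rw [Finset.disjoint_left]
    intro v hv hvC
    obtain ⟨comp, hcomp, hvt⟩ := Finset.mem_biUnion.mp hvC
    have hlt := (Finset.mem_filter.mp hcomp).2
    have hsub : Subsingleton comp.supp := by
      have key : ∀ x ∈ comp.supp, v = x := fun x hx =>
        (SimpleGraph.ConnectedComponent.exact
          ((mem_t comp v hvt).trans (hx : G.connectedComponentMk x = comp).symm)).eq_of_forall_not_adj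
          (isolated v hv)
      exact ⟨fun a b => Subtype.ext ((key a a.2).symm.trans (key b b.2))⟩
    have := Finite.card_le_one_iff_subsingleton.mpr hsub
    omega
  have card_t : (C.biUnion t).card = ∑ comp ∈ C, indepNum (G.induce comp.supp) := by
    rw [Finset.card_biUnion]
    · simp only [t, Finset.card_map, hcard]
    · intro a _ b _ hab
      exact Finset.disjoint_left.mpr fun v hva hvb =>
        hab ((mem_t a v hva).symm.trans (mem_t b v hvb))
  rw [← card_t, ← Finset.card_union_of_disjoint disj]
  apply IsIndepSet.card_le_indepNum
  intro x hx y hy hxy hadj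
  rcases Finset.mem_union.mp hx with hxM | hxC
  · exact isolated x hxM y hadj
  rcases Finset.mem_union.mp hy with hyM | hyC
  · exact isolated y hyM x hadj.symm
  obtain ⟨a, -, hxa⟩ := Finset.mem_biUnion.mp hxC
  obtain ⟨b, -, hyb⟩ := Finset.mem_biUnion.mp hyC
  obtain rfl : a = b := by
    rw [← mem_t a x hxa, ← mem_t b y hyb]
    exact SimpleGraph.ConnectedComponent.sound hadj.reachable
  obtain ⟨x', hx', rfl⟩ := Finset.mem_map.mp hxa
  obtain ⟨y', hy', rfl⟩ := Finset.mem_map.mp hyb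
  exact hs a hx' hy' (fun h => hxy (congrArg _ h)) hadj

theorem indepNum_induce_compl_closedNeighborhood_add_one_le {V : Type*} [Fintype V]
    (G : SimpleGraph V) (u : V) [Fintype ↥((insert u (G.neighborSet u))ᶜ)] :
    indepNum (G.induce ((insert u (G.neighborSet u))ᶜ)) + 1 ≤ indepNum G := by
  obtain ⟨s, hs, hcard⟩ :=
    exists_isIndepSet_card_eq_indepNum (G.induce ((insert u (G.neighborSet u))ᶜ))
  let t : Finset V := s.map (Function.Embedding.subtype _)
  have mem_t : ∀ v ∈ t, v ≠ u ∧ ¬ G.Adj u v := by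
    intro v hv
    obtain ⟨a, -, rfl⟩ := Finset.mem_map.mp hv
    have ha := a.2
    simp only [Set.mem_compl_iff, Set.mem_insert_iff, not_or, SimpleGraph.mem_neighborSet] at ha
    exact ha
  have hut : u ∉ t := fun h => (mem_t u h).1 rfl
  have hcons : (Finset.cons u t hut).card = s.card + 1 := by simp [t]
  rw [← hcard, ← hcons]
  apply IsIndepSet.card_le_indepNum
  intro x hx y hy hxy hadj
  rcases Finset.mem_cons.mp hx with rfl | hxt
  · rcases Finset.mem_cons.mp hy with rfl | hyt
    · exact hxy rfl
    · exact (mem_t y hyt).2 hadj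
  rcases Finset.mem_cons.mp hy with rfl | hyt
  · exact (mem_t x hxt).2 hadj.symm
  obtain ⟨x', hx', rfl⟩ := Finset.mem_map.mp hxt
  obtain ⟨y', hy', rfl⟩ := Finset.mem_map.mp hyt
  exact hs hx' hy' (fun h => hxy (congrArg _ h)) hadj

theorem mem_Icc_of_mul_add_succ_eq_one {Δ : ℕ} {c : ℕ → ℝ} (hcΔ : c Δ = 1 / (Δ : ℝ))
    (hrec : ∀ i : ℕ, 1 ≤ i → i ≤ Δ - 1 → (i : ℝ) * c i + c (i + 1) = 1)
    {i : ℕ} (hi : 1 ≤ i) (hiΔ : i ≤ Δ) : c i ∈ Set.Icc (0 : ℝ) 1 := by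
  induction hiΔ using Nat.decreasingInduction with
  | self =>
    rw [hcΔ]
    have : (1 : ℝ) ≤ Δ := by exact_mod_cast hi
    exact ⟨by positivity, (div_le_one (by positivity)).mpr this⟩
  | of_succ i hlt ih =>
    obtain ⟨h0, h1⟩ := ih (by omega)
    have h := hrec i hi (by omega)
    have hi' : (1 : ℝ) ≤ i := by exact_mod_cast hi
    constructor <;> nlinarith

open scoped Classical in
theorem stmt14 (Δ : ℕ) (hΔ : 4 ≤ Δ) {V : Type*} [Fintype V]
    (G : SimpleGraph V)
    (hconn : G.Connected) (hmax : G.maxDegree = Δ)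
    (hnotK : ¬ Nonempty (G ≃g (⊤ : SimpleGraph (Fin (Δ + 1)))))
    (hmin : G.minDegree ≤ Δ - 1)
    (c : ℕ → ℝ) (hcΔ : c Δ = 1 / (Δ : ℝ))
    (hrec : ∀ i : ℕ, 1 ≤ i → i ≤ Δ - 1 → (i : ℝ) * c i + c (i + 1) = 1)
    (u : V) (hu : G.degree u = G.minDegree)
    (hu1 : c (G.degree u) + ∑ w ∈ G.neighborFinset u, c (G.degree w) ≤ 1)
    -- `G'` is the induced subgraph of `G` on the complement of `{u} ∪ N_G(u)`
    (G' : SimpleGraph ↥((insert u (G.neighborSet u))ᶜ))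
    (hG' : G' = G.induce ((insert u (G.neighborSet u))ᶜ)) :
    -- sum of `f_G` over the isolated vertices `M` of `G'`
    (∑ v ∈ Finset.univ.filter
        (fun v : ↥((insert u (G.neighborSet u))ᶜ) => G'.degree v = 0),
        c (G.degree (v : V)))
      -- plus the sum of the independence numbers of the components of `G'`
      -- having at least two vertices
      + (∑ comp ∈ Finset.univ.filter
            (fun comp : G'.ConnectedComponent => 1 < Nat.card comp.supp),
          (indepNum (G'.induce comp.supp) : ℝ))
      + c (G.degree u) + (∑ w ∈ G.neighborFinset u, c (G.degree w))
      ≤ (indepNum G : ℝ) := by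
  have : Nontrivial V := by
    obtain ⟨x, hx⟩ := @SimpleGraph.exists_maximal_degree_vertex V G _ _ hconn.nonempty
    obtain ⟨y, hy⟩ := (G.degree_pos_iff_exists_adj x).mp (by omega)
    exact ⟨x, y, hy.ne⟩
  have hM := Finset.sum_le_card_nsmul
    (Finset.univ.filter fun v : ↥((insert u (G.neighborSet u))ᶜ) =>
      G'.degree v = 0)
    (fun v => c (G.degree (v : V))) 1 fun v _ =>
      (mem_Icc_of_mul_add_succ_eq_one hcΔ hrec
        (hconn.preconnected.degree_pos_of_nontrivial (v : V))
        (hmax ▸ G.degree_le_maxDegree (v : V))).2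
  rw [nsmul_one] at hM
  have hle : (Finset.univ.filter fun v => G'.degree v = 0).card
      + ∑ comp ∈ Finset.univ.filter
          (fun comp : G'.ConnectedComponent => 1 < Nat.card comp.supp),
        indepNum (G'.induce comp.supp) ≤ indepNum G' := by
    convert card_isolated_add_sum_indepNum_le G'
  have hα := (Nat.add_le_add_right hle 1).trans
    (hG' ▸ indepNum_induce_compl_closedNeighborhood_add_one_le G u)
  have hα' := (Nat.cast_le (α := ℝ)).mpr hα
  push_cast at hα'
  linarith
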